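/- Let p ≥ 7 be prime. Then N_=(4p) ≥ p² + 11p − 1, i.e. there exists a graph on p² + 11p − 2 vertices with no induced regular subgraph of order exactly 4p. -/

import Mathlib

/-- The induced subgraph of `G` on `s` is regular: all vertices of `s` have the same
number of neighbours within `s`. -/
def RegOn {V : Type*} (G : SimpleGraph V) (s : Set V) : Prop :=
  ∃ d : ℕ, ∀ v ∈ s, (s ∩ {w | G.Adj v w}).ncard = d

/-- `G` has a regular induced subgraph of order exactly `k`. -/
def HasRegEq {V : Type*} (G : SimpleGraph V) (k : ℕ) : Prop :=
  ∃ s : Set V, s.ncard = k ∧ RegOn G s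

/-- `G` has a regular induced subgraph of order at least `k`. -/
def HasRegGe {V : Type*} (G : SimpleGraph V) (k : ℕ) : Prop :=
  ∃ s : Set V, k ≤ s.ncard ∧ RegOn G s

/-- The least `n` such that every graph on `n` vertices has a regular induced subgraph
of order exactly `k`. -/
noncomputable def Neq (k : ℕ) : ℕ :=
  sInf {n | ∀ G : SimpleGraph (Fin n), HasRegEq G k}

/-- The least `n` such that every graph on `n` vertices has a regular induced subgraph
of order at least `k`. -/
noncomputable def Nge (k : ℕ) : ℕ :=
  sInf {n | ∀ G : SimpleGraph (Fin n), HasRegGe G k}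

/-- Ramsey's theorem for graphs, relative to a finite vertex set. -/
theorem exists_isNClique_or_compl_of_two_pow_le {V : Type*} (G : SimpleGraph V) (a b : ℕ)
    (s : Finset V) (hs : 2 ^ (a + b) ≤ s.card) :
    (∃ t ⊆ s, G.IsNClique a t) ∨ ∃ t ⊆ s, Gᶜ.IsNClique b t := by
  classical
  induction a generalizing b s with
  | zero => exact Or.inl ⟨∅, by simp, by simp⟩
  | succ a iha =>
    induction b generalizing s with
    | zero => exact Or.inr ⟨∅, by simp, by simp⟩
    | succ b ihb =>
      have hpos : 0 < s.card := lt_of_lt_of_le (by positivity) hs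
      obtain ⟨v, hv⟩ := Finset.card_pos.1 hpos
      have hsplit := Finset.card_filter_add_card_filter_not (s := s.erase v) (G.Adj v)
      rw [Finset.card_erase_of_mem hv] at hsplit
      have hpow : 2 ^ (a + 1 + (b + 1)) = 2 * 2 ^ (a + (b + 1)) := by ring
      have hpow' : 2 ^ (a + 1 + b) = 2 ^ (a + (b + 1)) := by congr 1; ring
      by_cases h : 2 ^ (a + (b + 1)) ≤ ((s.erase v).filter (G.Adj v)).card
      · rcases iha (b + 1) _ h with ⟨t, hts, ht⟩ | ⟨t, hts, ht⟩
        · refine Or.inl ⟨insert v t, ?_, ht.insert fun w hw => (Finset.mem_filter.1 (hts hw)).2⟩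
          exact Finset.insert_subset hv fun w hw =>
            Finset.mem_of_mem_erase (Finset.mem_filter.1 (hts hw)).1
        · exact Or.inr ⟨t, fun w hw =>
            Finset.mem_of_mem_erase (Finset.mem_filter.1 (hts hw)).1, ht⟩
      · have h' : 2 ^ (a + 1 + b) ≤ ((s.erase v).filter (fun w => ¬ G.Adj v w)).card := by
          omega
        rcases ihb _ h' with ⟨t, hts, ht⟩ | ⟨t, hts, ht⟩
        · exact Or.inl ⟨t, fun w hw =>
            Finset.mem_of_mem_erase (Finset.mem_filter.1 (hts hw)).1, ht⟩
        · refine Or.inr ⟨insert v t, ?_, ht.insert fun w hw => ?_⟩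
          · exact Finset.insert_subset hv fun w hw =>
              Finset.mem_of_mem_erase (Finset.mem_filter.1 (hts hw)).1
          · have hw' := Finset.mem_filter.1 (hts hw)
            exact (G.compl_adj v w).2 ⟨(Finset.ne_of_mem_erase hw'.1).symm, hw'.2⟩

theorem RegOn.of_isClique {V : Type*} {G : SimpleGraph V} {t : Finset V}
    (ht : G.IsClique (t : Set V)) : RegOn G (t : Set V) := by
  refine ⟨t.card - 1, fun v hv => ?_⟩
  have : (t : Set V) ∩ {w | G.Adj v w} = (t : Set V) \ {v} := by
    ext w
    simp only [Set.mem_inter_iff, Set.mem_ofPred_eq, Set.mem_sdiff, Set.mem_singleton_iff]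
    exact and_congr_right fun hw => ⟨fun h => h.ne', fun h => ht hv hw (Ne.symm h)⟩
  rw [this, Set.ncard_sdiff_singleton_of_mem hv, Set.ncard_coe_finset]

theorem RegOn.of_isClique_compl {V : Type*} {G : SimpleGraph V} {t : Finset V}
    (ht : Gᶜ.IsClique (t : Set V)) : RegOn G (t : Set V) := by
  refine ⟨0, fun v hv => ?_⟩
  have : (t : Set V) ∩ {w | G.Adj v w} = ∅ := by
    refine Set.eq_empty_of_forall_notMem fun w hw => ?_
    exact ((G.compl_adj v w).1 (ht hv hw.1 (G.ne_of_adj hw.2))).2 hw.2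
  rw [this, Set.ncard_empty]

theorem exists_forall_hasRegEq (k : ℕ) : ∃ n, ∀ G : SimpleGraph (Fin n), HasRegEq G k := by
  refine ⟨2 ^ (k + k), fun G => ?_⟩
  rcases exists_isNClique_or_compl_of_two_pow_le G k k Finset.univ (by simp) with
    ⟨t, -, ht⟩ | ⟨t, -, ht⟩
  · exact ⟨t, by rw [Set.ncard_coe_finset, ht.card_eq], .of_isClique ht.isClique⟩
  · exact ⟨t, by rw [Set.ncard_coe_finset, ht.card_eq], .of_isClique_compl ht.isClique⟩

theorem HasRegEq.of_comap {V W : Type*} {G : SimpleGraph V} {k : ℕ} (f : W ↪ V)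
    (h : HasRegEq (G.comap f) k) : HasRegEq G k := by
  obtain ⟨s, hs, d, hd⟩ := h
  refine ⟨f '' s, by rw [Set.ncard_image_of_injective s f.injective, hs], d, ?_⟩
  rintro _ ⟨v, hv, rfl⟩
  rw [← hd v hv, ← Set.ncard_image_of_injective _ f.injective]
  congr 1
  ext w
  constructor
  · rintro ⟨⟨u, hu, rfl⟩, hw⟩
    exact ⟨u, ⟨hu, hw⟩, rfl⟩
  · rintro ⟨u, ⟨hu, hw⟩, rfl⟩
    exact ⟨⟨u, hu, rfl⟩, hw⟩

theorem lt_Neq_of_not_hasRegEq {n k : ℕ} {G : SimpleGraph (Fin n)} (hG : ¬ HasRegEq G k) :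
    n < Neq k := by
  by_contra! h
  have hmem : ∀ G : SimpleGraph (Fin (Neq k)), HasRegEq G k :=
    Nat.sInf_mem (exists_forall_hasRegEq k)
  exact hG (.of_comap (Fin.castLEEmb h) (hmem _))

/-- A disjoint union, indexed by `ι`, of chains of four cliques with consecutive cliques
completely joined; `s (i, j)` is the order of the `j`-th clique of the `i`-th chain. -/
def cliqueChains {ι : Type*} (s : ι × Fin 4 → ℕ) : SimpleGraph (Σ x, Fin (s x)) where
  Adj v w := v ≠ w ∧ v.1.1 = w.1.1 ∧
    (v.1.2 : ℕ) ≤ (w.1.2 : ℕ) + 1 ∧ (w.1.2 : ℕ) ≤ (v.1.2 : ℕ) + 1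
  symm := ⟨fun _ _ h => ⟨h.1.symm, h.2.1.symm, h.2.2.2, h.2.2.1⟩⟩
  loopless := ⟨fun _ h => h.1 rfl⟩

/-- The number of vertices met in each clique by a regular induced subgraph of
`cliqueChains s`. -/
theorem RegOn.exists_counts {ι : Type*} [Fintype ι] {s : ι × Fin 4 → ℕ}
    {S : Finset (Σ x, Fin (s x))} (hS : RegOn (cliqueChains s) (S : Set (Σ x, Fin (s x)))) :
    ∃ (c : ι → Fin 4 → ℕ) (m : ℕ), 0 < m ∧ S.card = ∑ i, ∑ j, c i j ∧
      (∀ i j, c i j ≤ s (i, j)) ∧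
      ∀ i j, 0 < c i j →
        (∑ j' : Fin 4, if (j : ℕ) ≤ j' + 1 ∧ (j' : ℕ) ≤ j + 1 then c i j' else 0) = m := by
  classical
  obtain ⟨d, hd⟩ := hS
  refine ⟨fun i j => (S.filter (fun v => v.1 = (i, j))).card, d + 1, by omega, ?_, ?_, ?_⟩
  · rw [← Fintype.sum_prod_type' (f := fun i j => (S.filter (fun v => v.1 = (i, j))).card)]
    exact Finset.card_eq_sum_card_fiberwise fun _ _ => Finset.mem_coe.2 (Finset.mem_univ _)
  · intro i j
    calc (S.filter (fun v => v.1 = (i, j))).card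
        ≤ (Finset.univ.map (Function.Embedding.sigmaMk (β := fun x => Fin (s x)) (i, j))).card := by
          refine Finset.card_le_card ?_
          rintro ⟨x, k⟩ hx
          obtain rfl : x = (i, j) := (Finset.mem_filter.1 hx).2
          exact Finset.mem_map.2 ⟨k, Finset.mem_univ _, rfl⟩
      _ = s (i, j) := by simp
  · intro i j hij
    obtain ⟨v, hv⟩ := Finset.card_pos.1 hij
    obtain ⟨hvS, hvx⟩ := Finset.mem_filter.1 hv
    set T := S.filter fun w => w.1.1 = i ∧ (j : ℕ) ≤ (w.1.2 : ℕ) + 1 ∧ (w.1.2 : ℕ) ≤ (j : ℕ) + 1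
      with hT
    have hvT : v ∈ T := by simp [hT, hvS, hvx]
    have hnbr : (S : Set (Σ x, Fin (s x))) ∩ {w | (cliqueChains s).Adj v w} =
        (T.erase v : Finset (Σ x, Fin (s x))) := by
      ext w
      simp only [cliqueChains, hT, hvx, Set.mem_inter_iff, Finset.mem_coe, Set.mem_ofPred_eq,
        Finset.mem_erase, Finset.mem_filter]
      tauto
    have hcard : T.card = d + 1 := by
      rw [← hd v hvS, hnbr, Set.ncard_coe_finset, Finset.card_erase_add_one hvT]
    rw [← hcard, Finset.card_eq_sum_card_fiberwise (f := fun w => w.1.2) (t := Finset.univ)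
      fun _ _ => Finset.mem_coe.2 (Finset.mem_univ _)]
    refine Finset.sum_congr rfl fun j' _ => ?_
    rw [hT, Finset.filter_filter]
    split_ifs with h
    · refine congrArg Finset.card (Finset.ext fun w => ?_)
      simp only [Finset.mem_filter, Prod.ext_iff]
      refine and_congr_right fun _ => ⟨?_, ?_⟩
      · rintro ⟨h1, h2⟩
        exact ⟨⟨h1, by rw [h2]; exact h⟩, h2⟩
      · rintro ⟨⟨h1, -⟩, h2⟩
        exact ⟨h1, h2⟩
    · symm
      rw [Finset.card_eq_zero, Finset.filter_eq_empty_iff]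
      rintro w - ⟨⟨-, h1⟩, h2⟩
      rw [h2] at h1
      exact h h1

/-- The chains of the witnessing graph: three long chains, `p - 7` cliques of order `p - 1`,
`p` triangles and `2 * p` isolated vertices. -/
abbrev WitnessIndex (p : ℕ) : Type := Fin 3 ⊕ Fin (p - 7) ⊕ Fin p ⊕ Fin (2 * p)

/-- The orders of the cliques in the chains of the witnessing graph. -/
def witnessSize (p : ℕ) : WitnessIndex p × Fin 4 → ℕ
  | (.inl i, j) => if j = 1 then (if i = 0 then 3 * p else p) else p - 1
  | (.inr (.inl _), j) => if j = 0 then p - 1 else 0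
  | (.inr (.inr (.inl _)), j) => if j = 0 then 3 else 0
  | (.inr (.inr (.inr _)), j) => if j = 0 then 1 else 0

theorem card_witness {p : ℕ} (hp : 7 ≤ p) :
    Fintype.card (Σ x, Fin (witnessSize p x)) = p ^ 2 + 11 * p - 2 := by
  obtain ⟨q, rfl⟩ := Nat.exists_eq_add_of_le hp
  rw [Fintype.card_sigma]
  simp only [Fintype.card_fin]
  simp only [Fintype.sum_prod_type, Fintype.sum_sum_type, Fin.sum_univ_four, Fin.sum_univ_three,
    witnessSize, Finset.sum_const, Finset.card_univ, smul_eq_mul]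
  simp
  symm
  rw [Nat.sub_eq_iff_eq_add (by nlinarith)]
  ring

theorem dvd_four_mul_prime {p m : ℕ} (hp : p.Prime) (h : m ∣ 4 * p) :
    m = 1 ∨ m = 2 ∨ m = 4 ∨ m = p ∨ m = 2 * p ∨ m = 4 * p := by
  obtain ⟨x, y, hx, hy, rfl⟩ := Nat.dvd_mul.1 h
  have hx4 : x ≤ 4 := Nat.le_of_dvd (by norm_num) hx
  rcases (Nat.dvd_prime hp).1 hy with rfl | rfl <;> interval_cases x <;> simp_all

theorem sum_witnessIndex_le {p : ℕ} (n : WitnessIndex p → ℕ) (a b c : ℕ)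
    (ha : ∀ i, n (.inr (.inl i)) ≤ a) (hb : ∀ i, n (.inr (.inr (.inl i))) ≤ b)
    (hc : ∀ i, n (.inr (.inr (.inr i))) ≤ c) :
    ∑ i, n i ≤ n (.inl 0) + n (.inl 1) + n (.inl 2) + ((p - 7) * a + (p * b + 2 * p * c)) := by
  simp only [Fintype.sum_sum_type, Fin.sum_univ_three]
  have h1 := Finset.sum_le_card_nsmul Finset.univ _ a fun i _ => ha i
  have h2 := Finset.sum_le_card_nsmul Finset.univ _ b fun i _ => hb i
  have h3 := Finset.sum_le_card_nsmul Finset.univ _ c fun i _ => hc i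
  simp only [Finset.card_univ, Fintype.card_fin, smul_eq_mul] at h1 h2 h3
  omega

theorem dvd_sum_chain {m : ℕ} {c : Fin 4 → ℕ}
    (h : ∀ j, 0 < c j →
      (∑ j' : Fin 4, if (j : ℕ) ≤ j' + 1 ∧ (j' : ℕ) ≤ j + 1 then c j' else 0) = m) :
    m ∣ ∑ j, c j := by
  simp [Fin.forall_fin_succ, Fin.sum_univ_four] at h
  rw [Fin.sum_univ_four]
  have : c 0 + c 1 + c 2 + c 3 = m * 0 ∨ c 0 + c 1 + c 2 + c 3 = m * 1 ∨
      c 0 + c 1 + c 2 + c 3 = m * 2 := by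
    omega
  rcases this with h | h | h <;> exact ⟨_, h⟩

theorem long_chain_sum_le {p q m : ℕ} {c : Fin 4 → ℕ} (hp : 0 < p) (hpq : p ≤ q)
    (hc : ∀ j, c j ≤ if j = 1 then q else p - 1)
    (h : ∀ j, 0 < c j →
      (∑ j' : Fin 4, if (j : ℕ) ≤ j' + 1 ∧ (j' : ℕ) ≤ j + 1 then c j' else 0) = m) :
    ∑ j, c j ≤ 2 * m ∧ (p ≤ m → ∑ j, c j ≤ m) ∧ (p + q ≤ m → ∑ j, c j = 0) := by
  simp [Fin.forall_fin_succ, Fin.sum_univ_four] at h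
  simp [Fin.forall_fin_succ] at hc
  rw [Fin.sum_univ_four]
  omega

theorem short_chain_sum_le {m q : ℕ} {c : Fin 4 → ℕ} {P : Prop} [Decidable P] (hP : P → q < m)
    (hc : ∀ j, c j ≤ if j = 0 then q else 0)
    (h : ∀ j, 0 < c j →
      (∑ j' : Fin 4, if (j : ℕ) ≤ j' + 1 ∧ (j' : ℕ) ≤ j + 1 then c j' else 0) = m) :
    ∑ j, c j ≤ if P then 0 else m := by
  have h0 := h 0
  simp [Fin.sum_univ_four] at h0
  simp [Fin.forall_fin_succ] at hc
  rw [Fin.sum_univ_four]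
  split_ifs with hm
  · have := hP hm
    omega
  · omega

theorem chain_sums_lt {p m x y z : ℕ} (hp7 : 7 ≤ p)
    (hm : m = 1 ∨ m = 2 ∨ m = 4 ∨ m = p ∨ m = 2 * p ∨ m = 4 * p)
    (hx : x ≤ 2 * m ∧ (p ≤ m → x ≤ m) ∧ (p + 3 * p ≤ m → x = 0))
    (hy : y ≤ 2 * m ∧ (p ≤ m → y ≤ m) ∧ (p + p ≤ m → y = 0))
    (hz : z ≤ 2 * m ∧ (p ≤ m → z ≤ m) ∧ (p + p ≤ m → z = 0)) :
    x + y + z + ((p - 7) * (if p ≤ m then 0 else m) +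
      (p * (if 3 < m then 0 else m) + 2 * p * (if 1 < m then 0 else m))) < 4 * p := by
  by_cases h : p ≤ m
  · rw [if_pos h, if_pos (by omega), if_pos (by omega)]
    omega
  · rw [if_neg h]
    obtain rfl | rfl | rfl : m = 1 ∨ m = 2 ∨ m = 4 := by omega
    all_goals
      norm_num
      omega

theorem not_hasRegEq_witness {p : ℕ} (hp : p.Prime) (hp7 : 7 ≤ p) :
    ¬ HasRegEq (cliqueChains (witnessSize p)) (4 * p) := by
  rintro ⟨S, hS, hreg⟩
  lift S to Finset (Σ x, Fin (witnessSize p x)) using Set.toFinite S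
  rw [Set.ncard_coe_finset] at hS
  obtain ⟨c, m, hm, hcard, hle, hsum⟩ := hreg.exists_counts
  rw [hS] at hcard
  have hdvd : m ∣ 4 * p := by
    rw [hcard]
    exact Finset.dvd_sum fun i _ => dvd_sum_chain (hsum i)
  have hbound := sum_witnessIndex_le (fun i => ∑ j, c i j)
    (if p ≤ m then 0 else m) (if 3 < m then 0 else m) (if 1 < m then 0 else m)
    (fun i => short_chain_sum_le (q := p - 1) (by omega) (fun j => hle _ j) (hsum _))
    (fun i => short_chain_sum_le (q := 3) (by omega) (fun j => hle _ j) (hsum _))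
    (fun i => short_chain_sum_le (q := 1) (by omega) (fun j => hle _ j) (hsum _))
  rw [← hcard] at hbound
  refine absurd hbound (not_le.2 (chain_sums_lt hp7 (dvd_four_mul_prime hp hdvd) ?_ ?_ ?_))
  · exact long_chain_sum_le (by omega) (by omega) (fun j => hle (.inl 0) j) (hsum _)
  · exact long_chain_sum_le (by omega) le_rfl (fun j => hle (.inl 1) j) (hsum _)
  · exact long_chain_sum_le (by omega) le_rfl (fun j => hle (.inl 2) j) (hsum _)

theorem Neq_lower_bound_4p (p : ℕ) (hp : p.Prime) (hp7 : 7 ≤ p) :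
    (∃ G : SimpleGraph (Fin (p^2 + 11*p - 2)), ¬ HasRegEq G (4 * p)) ∧
    p^2 + 11*p - 1 ≤ Neq (4 * p) := by
  have hG : ∃ G : SimpleGraph (Fin (p^2 + 11*p - 2)), ¬ HasRegEq G (4 * p) :=
    ⟨(cliqueChains (witnessSize p)).comap
      (Fintype.equivFinOfCardEq (card_witness hp7)).symm.toEmbedding,
      fun h => not_hasRegEq_witness hp hp7 (.of_comap _ h)⟩
  obtain ⟨G, h⟩ := hG
  have := lt_Neq_of_not_hasRegEq h
  exact ⟨⟨G, h⟩, by omega⟩
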